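/- Let σ and n be positive integers with σ < n, and write n = mσ + p with 0 ≤ p < σ. The string w = a₁^m ⋯ a_{σ−p}^m a_{σ−p+1}^{m+1} ⋯ a_σ^{m+1} (the concatenation, in increasing alphabetical order a₁ < … < a_σ, of σ−p blocks of length m followed by p blocks of length m+1) has exactly 2^n − (p + σ)·2^m + n + σ − 1 occurrences of Lyndon subsequences, i.e., it attains the maximum total number of Lyndon subsequences among all strings of length n over an alphabet of size σ. -/

import Mathlib

/-- A nonempty string is a Lyndon word if it is lexicographically strictly smaller
than all of its nonempty proper suffixes. -/
def IsLyndon {α : Type*} [LinearOrder α] (w : List α) : Prop :=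
  w ≠ [] ∧ ∀ i, 0 < i → i < w.length → List.Lex (· < ·) w (w.drop i)

/-- The subsequence of `w` extracted at the set of positions `S` (taken in increasing order). -/
def subseqAt {α : Type*} (w : List α) (S : Finset (Fin w.length)) : List α :=
  (S.sort (· ≤ ·)).map w.get

/-- The total number of occurrences of Lyndon subsequences in `w`: the number of
(nonempty) sets of positions whose extracted word is a Lyndon word. -/
noncomputable def totalLyndonSubseq {α : Type*} [LinearOrder α] (w : List α) : ℕ :=
  Nat.card {S : Finset (Fin w.length) // IsLyndon (subseqAt w S)}

/-- The string a₁^{k₁} a₂^{k₂} ⋯ a_σ^{k_σ} over the alphabet Fin σ. -/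
def blockString (σ : ℕ) (k : Fin σ → ℕ) : List (Fin σ) :=
  (List.finRange σ).flatMap fun c => List.replicate (k c) c

/-- A sorted word which is not constant is lexicographically smaller than each of its
nonempty proper suffixes. -/
lemma lex_suffix_of_pairwise_le {α : Type*} [LinearOrder α] (x : α) (l s : List α)
    (hl : (x :: l).Pairwise (· ≤ ·)) (hne : ∃ y ∈ l, y ≠ x) (hs : s <:+ l) (hs0 : s ≠ []) :
    List.Lex (· < ·) (x :: l) s := by
  induction l generalizing s with
  | nil => simp at hne
  | cons y l ih =>
    obtain ⟨z, t, rfl⟩ := List.exists_cons_of_ne_nil hs0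
    have hx : ∀ b ∈ y :: l, x ≤ b := (List.pairwise_cons.1 hl).1
    have hy : ∀ b ∈ l, y ≤ b := (List.pairwise_cons.1 (List.pairwise_cons.1 hl).2).1
    rcases (hx y (by simp)).lt_or_eq with hxy | rfl
    · refine List.Lex.rel ?_
      rcases List.mem_cons.1 (hs.subset List.mem_cons_self) with h | h
      · exact h ▸ hxy
      · exact hxy.trans_le (hy z h)
    · have hl' : (x :: l).Pairwise (· ≤ ·) := (List.pairwise_cons.1 hl).2
      have hne' : ∃ y ∈ l, y ≠ x := by
        obtain ⟨b, hb, hbx⟩ := hne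
        exact ⟨b, (List.mem_cons.1 hb).resolve_left hbx, hbx⟩
      rcases List.suffix_cons_iff.1 hs with h | h
      · obtain ⟨rfl, rfl⟩ := List.cons.inj h
        have ht : t ≠ [] := by
          rintro rfl
          simp at hne'
        exact List.Lex.cons (ih t hl' hne' List.suffix_rfl ht)
      · cases ih (z :: t) hl' hne' h (by simp) with
        | rel hlt => exact List.Lex.rel hlt
        | cons hlex =>
          refine List.Lex.cons (ih t hl' hne' ((List.suffix_cons _ _).trans h) ?_)
          rintro rfl
          cases hlex

/-- A sorted word is Lyndon as soon as it is a single letter or not constant. -/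
lemma isLyndon_of_pairwise_le {α : Type*} [LinearOrder α] {w : List α}
    (hw : w.Pairwise (· ≤ ·)) (h0 : w ≠ [])
    (h : (∃ c, ∀ x ∈ w, x = c) → w.length = 1) : IsLyndon w := by
  refine ⟨h0, fun i hi hiw => ?_⟩
  obtain ⟨x, l, rfl⟩ := List.exists_cons_of_ne_nil h0
  obtain ⟨j, rfl⟩ := Nat.exists_eq_succ_of_ne_zero hi.ne'
  refine lex_suffix_of_pairwise_le x l _ hw ?_ (by simpa using List.drop_suffix j l) ?_
  · by_contra! hc
    have := h ⟨x, by simpa using hc⟩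
    omega
  · rw [← List.length_pos_iff_ne_nil, List.length_drop]
    omega

lemma not_lex_replicate_succ {α : Type*} [LinearOrder α] (c : α) (k : ℕ) :
    ¬ List.Lex (· < ·) (List.replicate (k + 1) c) (List.replicate k c) := by
  induction k with
  | zero => exact List.not_lex_nil
  | succ k ih =>
    rw [List.replicate_succ (n := k + 1), List.replicate_succ (n := k), List.lex_cons_iff]
    exact ih

/-- A constant Lyndon word is a single letter. -/
lemma IsLyndon.length_eq_one {α : Type*} [LinearOrder α] {w : List α} (hw : IsLyndon w)
    {c : α} (hc : ∀ x ∈ w, x = c) : w.length = 1 := by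
  by_contra hne
  have h0 := List.length_pos_iff_ne_nil.2 hw.1
  have hlex := hw.2 1 one_pos (by omega)
  rw [List.eq_replicate_of_mem hc, List.drop_replicate] at hlex
  obtain ⟨k, hk⟩ : ∃ k, w.length = k + 1 := ⟨w.length - 1, by omega⟩
  rw [hk] at hlex
  exact not_lex_replicate_succ c k hlex

@[simp]
lemma length_subseqAt {α : Type*} (w : List α) (S : Finset (Fin w.length)) :
    (subseqAt w S).length = S.card := by
  simp [subseqAt]

lemma subseqAt_eq_nil {α : Type*} (w : List α) (S : Finset (Fin w.length)) :
    subseqAt w S = [] ↔ S = ∅ := by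
  rw [← List.length_eq_zero_iff, length_subseqAt, Finset.card_eq_zero]

lemma forall_mem_subseqAt {α : Type*} (w : List α) (S : Finset (Fin w.length)) (c : α) :
    (∀ x ∈ subseqAt w S, x = c) ↔ ∀ i ∈ S, w.get i = c := by
  simp [subseqAt]

lemma pairwise_subseqAt {α : Type*} [LinearOrder α] {w : List α} (hw : w.Pairwise (· ≤ ·))
    (S : Finset (Fin w.length)) : (subseqAt w S).Pairwise (· ≤ ·) := by
  rw [subseqAt, List.pairwise_map]
  refine (Finset.pairwise_sort S (· ≤ ·)).imp fun {a b} hab => ?_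
  rcases hab.lt_or_eq with h | rfl
  · exact List.pairwise_iff_get.1 hw a b h
  · exact le_rfl

/-- The positions of the letter `c` in `w`. -/
def positions {α : Type*} [DecidableEq α] (w : List α) (c : α) : Finset (Fin w.length) :=
  Finset.univ.filter fun i => w.get i = c

lemma card_positions {α : Type*} [DecidableEq α] (w : List α) (c : α) :
    (positions w c).card = w.count c := by
  have h := Fin.card_filter_univ_eq_vector_get_eq_count c (⟨w, rfl⟩ : List.Vector α w.length)
  rw [positions, show w.count c = _ from h.symm]
  congr 1

lemma sum_count_eq_length {α : Type*} [DecidableEq α] [Fintype α] (w : List α) :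
    ∑ c, w.count c = w.length := by
  simp_rw [← card_positions]
  have h := Finset.card_eq_sum_card_fiberwise (s := Finset.univ) (t := Finset.univ)
    (f := w.get) (fun _ _ => by simp)
  rw [Finset.card_univ, Fintype.card_fin] at h
  exact h.symm

/-- The nonempty sets of positions that select a single letter or a non-constant word. -/
noncomputable def lyndonCandidates {α : Type*} (w : List α) : Finset (Finset (Fin w.length)) :=
  open Classical in
  Finset.univ.filter fun S => S ≠ ∅ ∧ ((∃ c, ∀ i ∈ S, w.get i = c) → S.card = 1)

lemma totalLyndonSubseq_le {α : Type*} [LinearOrder α] (w : List α) :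
    totalLyndonSubseq w ≤ (lyndonCandidates w).card := by
  classical
  rw [totalLyndonSubseq, Nat.card_eq_fintype_card, Fintype.card_subtype]
  refine Finset.card_le_card fun S hS => ?_
  simp only [Finset.mem_filter, Finset.mem_univ, true_and, lyndonCandidates] at hS ⊢
  refine ⟨fun h => hS.1 ((subseqAt_eq_nil w S).2 h), fun ⟨c, hc⟩ => ?_⟩
  rw [← length_subseqAt]
  exact hS.length_eq_one ((forall_mem_subseqAt w S c).2 hc)

lemma totalLyndonSubseq_of_pairwise_le {α : Type*} [LinearOrder α] {w : List α}
    (hw : w.Pairwise (· ≤ ·)) : totalLyndonSubseq w = (lyndonCandidates w).card := by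
  classical
  refine (totalLyndonSubseq_le w).antisymm ?_
  rw [totalLyndonSubseq, Nat.card_eq_fintype_card, Fintype.card_subtype]
  refine Finset.card_le_card fun S hS => ?_
  simp only [Finset.mem_filter, Finset.mem_univ, true_and, lyndonCandidates] at hS ⊢
  refine isLyndon_of_pairwise_le (pairwise_subseqAt hw S)
    (fun h => hS.1 ((subseqAt_eq_nil w S).1 h)) fun ⟨c, hc⟩ => ?_
  rw [length_subseqAt]
  exact hS.2 ⟨c, (forall_mem_subseqAt w S c).1 hc⟩

lemma card_powerset_filter_one_lt {β : Type*} [DecidableEq β] (s : Finset β) :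
    (s.powerset.filter fun S => 1 < S.card).card + s.card + 1 = 2 ^ s.card := by
  have h : (s.powerset.filter fun S => ¬ 1 < S.card)
      = s.powersetCard 0 ∪ s.powersetCard 1 := by
    ext S
    simp only [Finset.mem_filter, Finset.mem_powerset, Finset.mem_union,
      Finset.mem_powersetCard]
    grind
  have hd : Disjoint (s.powersetCard 0) (s.powersetCard 1) :=
    Finset.pairwise_disjoint_powersetCard s zero_ne_one
  have := Finset.card_filter_add_card_filter_not (s := s.powerset) fun S => 1 < S.card
  rw [h, Finset.card_union_of_disjoint hd] at this
  simp at this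
  omega

lemma card_lyndonCandidates {α : Type*} [LinearOrder α] [Fintype α] (w : List α) :
    (lyndonCandidates w).card + ∑ c, 2 ^ w.count c + 1
      = 2 ^ w.length + w.length + Fintype.card α := by
  classical
  set B := Finset.univ.biUnion fun c => (positions w c).powerset.filter fun S => 1 < S.card
    with hB
  have hcompl : (lyndonCandidates w)ᶜ = insert ∅ B := by
    ext S
    simp only [lyndonCandidates, hB, positions, Finset.mem_compl, Finset.mem_filter,
      Finset.mem_univ, true_and, Finset.mem_insert, Finset.mem_biUnion, Finset.mem_powerset,
      Finset.subset_iff]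
    by_cases hS : S = ∅
    · simp [hS]
    · have := Finset.card_pos.2 (Finset.nonempty_iff_ne_empty.2 hS)
      simp only [hS, ne_eq, not_false_eq_true, true_and, false_or, Classical.not_imp]
      constructor
      · rintro ⟨⟨c, hc⟩, h1⟩
        exact ⟨c, fun {i} hi => hc i hi, by omega⟩
      · rintro ⟨c, hc, h1⟩
        exact ⟨⟨c, fun i hi => hc hi⟩, by omega⟩
  have hempty : ∅ ∉ B := by simp [hB]
  have hBcard : B.card + w.length + Fintype.card α = ∑ c, 2 ^ w.count c := by
    rw [hB, Finset.card_biUnion]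
    · have := Finset.sum_congr rfl fun c (_ : c ∈ (Finset.univ : Finset α)) =>
        card_powerset_filter_one_lt (positions w c)
      simp only [Finset.sum_add_distrib, card_positions, sum_count_eq_length] at this
      simpa using this
    · intro c _ d _ hcd
      refine Finset.disjoint_left.2 fun S hc hd => hcd ?_
      simp only [Finset.mem_filter, Finset.mem_powerset, positions, Finset.subset_iff,
        Finset.mem_univ, true_and] at hc hd
      obtain ⟨i, hi⟩ := Finset.card_pos.1 (zero_lt_one.trans hc.2)
      exact (hc.1 hi).symm.trans (hd.1 hi)
  have htotal := Finset.card_add_card_compl (lyndonCandidates w)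
  rw [hcompl, Finset.card_insert_of_notMem hempty, Fintype.card_finset, Fintype.card_fin]
    at htotal
  omega

lemma pairwise_blockString (σ : ℕ) (k : Fin σ → ℕ) :
    (blockString σ k).Pairwise (· ≤ ·) := by
  rw [blockString, List.pairwise_flatMap]
  refine ⟨fun c _ => List.pairwise_replicate.2 (Or.inr le_rfl), ?_⟩
  refine (List.pairwise_le_finRange σ).imp fun {a b} hab x hx y hy => ?_
  rwa [List.eq_of_mem_replicate hx, List.eq_of_mem_replicate hy]

lemma count_blockString (σ : ℕ) (k : Fin σ → ℕ) (c : Fin σ) :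
    (blockString σ k).count c = k c := by
  rw [blockString, List.count_flatMap, ← Fin.sum_univ_def]
  simp [Function.comp_apply, List.count_replicate]

lemma card_filter_val_lt_sub (σ p : ℕ) (hp : p ≤ σ) :
    (Finset.univ.filter fun c : Fin σ => (c : ℕ) < σ - p).card = σ - p := by
  rw [Fin.card_filter_val_lt]
  omega

lemma sum_ite_val_lt_sub (σ p x y : ℕ) (hp : p ≤ σ) :
    ∑ c : Fin σ, (if (c : ℕ) < σ - p then x else y) = (σ - p) * x + p * y := by
  have h := Finset.card_filter_add_card_filter_not
    (s := (Finset.univ : Finset (Fin σ))) fun c => (c : ℕ) < σ - p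
  rw [card_filter_val_lt_sub σ p hp, Finset.card_univ, Fintype.card_fin] at h
  rw [Finset.sum_ite, Finset.sum_const, Finset.sum_const, card_filter_val_lt_sub σ p hp,
    show (Finset.univ.filter fun c : Fin σ => ¬ (c : ℕ) < σ - p).card = p by omega,
    smul_eq_mul, smul_eq_mul]

/-- The tangent-line inequality for `k ↦ 2 ^ k` on the integers. -/
lemma two_pow_mul_succ_le (m k : ℕ) : 2 ^ m * (k + 1) ≤ 2 ^ k + 2 ^ m * m := by
  rcases le_total m k with h | h
  · obtain ⟨d, rfl⟩ := Nat.exists_eq_add_of_le h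
    have := Nat.mul_le_mul_left (2 ^ m) (Nat.succ_le_of_lt (Nat.lt_two_pow_self (n := d)))
    rw [← pow_add] at this
    simp only [Nat.succ_eq_add_one] at this
    linarith
  · rcases h.lt_or_eq with h | rfl
    · exact (Nat.mul_le_mul_left _ h).trans (Nat.le_add_left _ _)
    · linarith

/-- Among families of natural numbers with a given sum, balanced ones minimise `∑ 2 ^ k`. -/
lemma mul_two_pow_le_sum_two_pow {ι : Type*} [Fintype ι] (k : ι → ℕ) (m p : ℕ)
    (hk : ∑ c, k c = m * Fintype.card ι + p) :
    (p + Fintype.card ι) * 2 ^ m ≤ ∑ c, 2 ^ k c := by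
  have h := Finset.sum_le_sum fun c (_ : c ∈ Finset.univ) => two_pow_mul_succ_le m (k c)
  rw [← Finset.mul_sum, Finset.sum_add_distrib, Finset.sum_add_distrib, hk] at h
  simp only [Finset.sum_const, Finset.card_univ, smul_eq_mul, mul_one] at h
  linarith

lemma add_mul_two_pow_le (σ m p : ℕ) (hσ : 0 < σ) (hm : 0 < m) :
    (p + σ) * 2 ^ m ≤ 2 ^ (m * σ + p) := by
  obtain ⟨s, rfl⟩ := Nat.exists_eq_succ_of_ne_zero hσ.ne'
  have h1 : p + (s + 1) ≤ 2 ^ (p + s) := Nat.lt_two_pow_self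
  have h2 : p + s ≤ m * s + p := by nlinarith
  calc (p + (s + 1)) * 2 ^ m ≤ 2 ^ (m * s + p) * 2 ^ m :=
        Nat.mul_le_mul_right _ (h1.trans (Nat.pow_le_pow_right two_pos h2))
    _ = 2 ^ (m * (s + 1) + p) := by rw [← pow_add]; congr 1; ring

theorem extremal_string_attains_maximum (σ n m p : ℕ) (hσ : 0 < σ) (hσn : σ < n)
    (hn : n = m * σ + p) (hp : p < σ) :
    (blockString σ fun c => if (c : ℕ) < σ - p then m else m + 1).length = n ∧
    totalLyndonSubseq (blockString σ fun c => if (c : ℕ) < σ - p then m else m + 1)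
      = 2 ^ n - (p + σ) * 2 ^ m + n + σ - 1 ∧
    ∀ u : List (Fin σ), u.length = n →
      totalLyndonSubseq u ≤
        totalLyndonSubseq (blockString σ fun c => if (c : ℕ) < σ - p then m else m + 1) := by
  set w := blockString σ fun c => if (c : ℕ) < σ - p then m else m + 1 with hw
  obtain ⟨q, rfl⟩ := Nat.exists_eq_add_of_le hp.le
  have hm : 0 < m := by
    rcases Nat.eq_zero_or_pos m with rfl | h
    · omega
    · exact h
  have hlen : w.length = n := by
    rw [← sum_count_eq_length]
    simp only [hw, count_blockString]
    rw [sum_ite_val_lt_sub _ _ _ _ hp.le, hn, Nat.add_sub_cancel_left]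
    ring
  have hsum : ∑ c, 2 ^ w.count c = (p + (p + q)) * 2 ^ m := by
    simp only [hw, count_blockString, apply_ite (fun k => 2 ^ k)]
    rw [sum_ite_val_lt_sub _ _ _ _ hp.le, Nat.add_sub_cancel_left]
    ring
  have hcard := card_lyndonCandidates w
  rw [← totalLyndonSubseq_of_pairwise_le (w := w) (pairwise_blockString _ _), hsum,
    hlen, Fintype.card_fin] at hcard
  refine ⟨hlen, ?_, fun u hu => ?_⟩
  · have hle := add_mul_two_pow_le (p + q) m p hσ hm
    rw [← hn] at hle
    omega
  · have hu' := card_lyndonCandidates u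
    have hmin := mul_two_pow_le_sum_two_pow (fun c => u.count c) m p
      (by rw [sum_count_eq_length, Fintype.card_fin, hu, hn])
    simp only [hu, Fintype.card_fin] at hu'
    rw [Fintype.card_fin] at hmin
    have := totalLyndonSubseq_le u
    omega
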